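/- For all integers r ≥ 1 and 0 ≤ k ≤ r, one has Σ_{j=k}^{r} (-1)^{r-j}·e_{r-j}(a_1, a_0, a_{-1}, …, a_{2-r})·h_{j-k}(a_1, a_0, a_{-1}, …, a_{1-k}) = δ_{kr} in the polynomial ring ℚ[a_i : i ∈ ℤ], where the first argument list consists of the r variables a_1, a_0, …, a_{2-r} and the second of the k+1 variables a_1, a_0, …, a_{1-k}. -/

import Mathlib

open MvPolynomial

noncomputable section

/-- `ℚ[a]`: the polynomial ring over `ℚ` in the variables `a_i`, `i ∈ ℤ`. -/
abbrev Qa : Type := MvPolynomial ℤ ℚ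

/-- Elementary symmetric polynomials of a list of variables
(`e_0 = 1`, `e_m = 0` for `m` exceeding the number of variables). -/
def epoly : List Qa → ℕ → Qa
  | [], 0 => 1
  | [], _ + 1 => 0
  | _ :: vs, 0 => epoly vs 0
  | v :: vs, m + 1 => epoly vs (m + 1) + v * epoly vs m

/-- Complete homogeneous symmetric polynomials of a list of variables. -/
def hpoly : List Qa → ℕ → Qa
  | [], 0 => 1
  | [], _ + 1 => 0
  | v :: vs, m => ∑ k ∈ Finset.range (m + 1), v ^ k * hpoly vs (m - k)

theorem epoly_zero (vs : List Qa) : epoly vs 0 = 1 := by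
  induction vs with
  | nil => rfl
  | cons v vs ih => simpa [epoly] using ih

theorem epoly_eq_zero_of_length_lt (vs : List Qa) (m : ℕ) (h : vs.length < m) :
    epoly vs m = 0 := by
  induction vs generalizing m with
  | nil => cases m with
    | zero => simp at h
    | succ m => rfl
  | cons v vs ih => cases m with
    | zero => simp at h
    | succ m =>
      simp only [List.length_cons] at h
      simp [epoly, ih (m + 1) (by lia), ih m (by lia)]

theorem hpoly_zero (vs : List Qa) : hpoly vs 0 = 1 := by
  induction vs with
  | nil => rfl
  | cons v vs ih => simpa [hpoly] using ih

/-- The signed generating series `∑ (-1)^m e_m t^m` of the elementary symmetric polynomials. -/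
def eSeries (vs : List Qa) : PowerSeries Qa :=
  PowerSeries.mk fun m => (-1) ^ m * epoly vs m

/-- The generating series `∑ h_m t^m` of the complete homogeneous symmetric polynomials. -/
def hSeries (vs : List Qa) : PowerSeries Qa :=
  PowerSeries.mk (hpoly vs)

theorem eSeries_nil : eSeries [] = 1 := by
  ext1 m
  cases m <;> simp [eSeries, epoly, PowerSeries.coeff_one]

theorem hSeries_nil : hSeries [] = 1 := by
  ext1 m
  cases m <;> simp [hSeries, hpoly, PowerSeries.coeff_one]

theorem eSeries_cons (v : Qa) (vs : List Qa) :
    eSeries (v :: vs) = (1 - PowerSeries.X * PowerSeries.C v) * eSeries vs := by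
  ext1 m
  rw [sub_mul, one_mul, mul_assoc, map_sub]
  cases m with
  | zero => simp [eSeries, epoly]
  | succ m =>
    simp only [eSeries, epoly, PowerSeries.coeff_mk, PowerSeries.coeff_succ_X_mul,
      PowerSeries.coeff_C_mul]
    ring

theorem eSeries_append (us vs : List Qa) :
    eSeries (us ++ vs) = eSeries us * eSeries vs := by
  induction us with
  | nil => simp [eSeries_nil]
  | cons u us ih => rw [List.cons_append, eSeries_cons, ih, eSeries_cons, mul_assoc]

theorem hSeries_cons (v : Qa) (vs : List Qa) :
    hSeries (v :: vs) = PowerSeries.mk (v ^ ·) * hSeries vs := by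
  ext1 m
  rw [PowerSeries.coeff_mul, Finset.Nat.sum_antidiagonal_eq_sum_range_succ_mk]
  simp [hSeries, hpoly]

theorem one_sub_X_mul_C_mul_geometric (v : Qa) :
    (1 - PowerSeries.X * PowerSeries.C v) * PowerSeries.mk (v ^ ·) = 1 := by
  ext1 m
  rw [sub_mul, one_mul, mul_assoc, map_sub]
  cases m with
  | zero => simp
  | succ m =>
    simp [PowerSeries.coeff_succ_X_mul, PowerSeries.coeff_one, pow_succ']

theorem eSeries_mul_hSeries (vs : List Qa) : eSeries vs * hSeries vs = 1 := by
  induction vs with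
  | nil => simp [eSeries_nil, hSeries_nil]
  | cons v vs ih =>
    rw [eSeries_cons, hSeries_cons, mul_mul_mul_comm, one_sub_X_mul_C_mul_geometric, ih, one_mul]

/-- Alternating convolution of elementary symmetric polynomials in `us ++ vs` with complete
homogeneous ones in `us` leaves the elementary symmetric polynomials in `vs`. -/
theorem sum_range_epoly_append_mul_hpoly (us vs : List Qa) (n : ℕ) :
    ∑ i ∈ Finset.range (n + 1), (-1) ^ (n - i) * epoly (us ++ vs) (n - i) * hpoly us i =
      (-1) ^ n * epoly vs n := by
  have h : hSeries us * eSeries (us ++ vs) = eSeries vs := by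
    rw [eSeries_append, ← mul_assoc, mul_comm (hSeries us), eSeries_mul_hSeries, one_mul]
  have hn := congrArg (PowerSeries.coeff n) h
  rw [PowerSeries.coeff_mul, Finset.Nat.sum_antidiagonal_eq_sum_range_succ_mk] at hn
  simpa [hSeries, eSeries, mul_comm] using hn

/-- `Σ_{j=k}^r (-1)^{r-j} e_{r-j}(a_1, a_0, …, a_{2-r}) h_{j-k}(a_1, a_0, …, a_{1-k}) = δ_{kr}`,
where the first list consists of the `r` variables `a_1, a_0, …, a_{2-r}` and the second of
the `k+1` variables `a_1, a_0, …, a_{1-k}`. -/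
theorem alternating_eh_identity (r k : ℕ) (hr : 1 ≤ r) (hk : k ≤ r) :
    ∑ j ∈ Finset.Icc k r, (-1 : Qa) ^ (r - j) *
        epoly ((List.range r).map (fun t => (X (1 - (t : ℤ)) : Qa))) (r - j) *
        hpoly ((List.range (k + 1)).map (fun t => (X (1 - (t : ℤ)) : Qa))) (j - k)
      = if k = r then 1 else 0 := by
  split_ifs with hkr
  · subst hkr
    simp [epoly_zero, hpoly_zero]
  · obtain ⟨d, rfl⟩ : ∃ d, r = k + 1 + d := ⟨r - (k + 1), by lia⟩
    simp only [bind_pure_comp, List.map_eq_map]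
    rw [List.range_add, List.map_append, List.map_append, ← Finset.Ico_add_one_right_eq_Icc,
      Finset.sum_Ico_eq_sum_range]
    have hsub (i : ℕ) : k + 1 + d - (k + i) = d + 1 - i := by lia
    simp only [hsub, Nat.add_sub_cancel_left]
    rw [show k + 1 + d + 1 - k = d + 1 + 1 by lia, sum_range_epoly_append_mul_hpoly,
      epoly_eq_zero_of_length_lt _ _ (by simp), mul_zero]

end
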